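/- arXiv:1001.0586 — 2 statements merged into one kernel-verified Lean document; each statement's English description precedes it below -/
import Mathlib

section
/- For every (u,v,w) ∈ ℝ³, writing b = b(u,v,w), c = c(u,v,w), a = a(u,v,w): the affine line E[o,r] through o and r intersects the translated affine line E[s,p]+b+c if and only if u/2 + 2v − w = 33/320, and the affine line E[o,p] through o and p intersects the translated affine line E[s,q]+c+a if and only if −u/2 − 2v − w = 33/320. -/
open Matrix MeasureTheory

noncomputable section

/-- Points of ℝ³. -/
abbrev V3 := Fin 3 → ℝ

/-- The vertices of the dimer. -/
def po : V3 := ![2, 2, 2]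
def pp : V3 := ![2, -1, -1]
def pq : V3 := ![-1, 2, -1]
def pr : V3 := ![-1, -1, 2]
def ps : V3 := ![-2, -2, -2]

/-- The positive dimer: convex hull of o, p, q, r, s. -/
def F2 : Set V3 := convexHull ℝ {po, pp, pq, pr, ps}

/-- The negative dimer: image of F₂ under the point reflection x ↦ -x. -/
def negF2 : Set V3 := (fun x => -x) '' F2

/-- L⁺ : integer combinations nₐ·a + n_b·b + n_c·c with nₐ+n_b+n_c even. -/
def Lplus (a b c : V3) : Set V3 :=
  {x | ∃ na nb nc : ℤ, Even (na + nb + nc) ∧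
    x = (na : ℝ) • a + (nb : ℝ) • b + (nc : ℝ) • c}

/-- L⁻ : integer combinations nₐ·a + n_b·b + n_c·c with nₐ+n_b+n_c odd, translated by d. -/
def Lminus (a b c d : V3) : Set V3 :=
  {x | ∃ na nb nc : ℤ, Odd (na + nb + nc) ∧
    x = (na : ℝ) • a + (nb : ℝ) • b + (nc : ℝ) • c + d}

/-- The double dimer configuration determined by (a,b,c,d). -/
def config (a b c d : V3) : Set (Set V3) :=
  {S | ∃ l ∈ Lplus a b c, S = (· + l) '' F2} ∪
  {S | ∃ m ∈ Lminus a b c d, S = (· + m) '' negF2}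

/-- A family of sets is a packing if distinct members have disjoint interiors. -/
def IsPacking (C : Set (Set V3)) : Prop :=
  ∀ S ∈ C, ∀ T ∈ C, S ≠ T → interior S ∩ interior T = ∅

/-- Determinant of the 3×3 matrix with columns x, y, z. -/
def det3 (x y z : V3) : ℝ := Matrix.det (Matrix.of fun i j => ![x, y, z] j i)

/-- The three-parameter family: lattice vectors a, b, c and offset d. -/
def av (u v w : ℝ) : V3 := ![27/10 + u, 21/20 - v, -3/20 + 2*u + v]
def bv (u v w : ℝ) : V3 := ![-3/10 - u, 51/20 + v, 27/20 - 2*u - v]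
def cv (u v w : ℝ) : V3 :=
  ![129/160 - u + 2*v + 2*w, -237/320 + u/2 - v + 3*w, 753/320 + u/2 - v + w]
def dv (u v w : ℝ) : V3 := ![1/10 + u, -1/20 + u + v, -1/20 + u - v]

/-- F[x,y,z] : the affine plane (affine span) through x, y, z. -/
def Fpl (x y z : V3) : Set V3 := (affineSpan ℝ {x, y, z} : Set V3)

/-- E[x,y] : the affine line through x and y. -/
def Eln (x y : V3) : Set V3 := (affineSpan ℝ {x, y} : Set V3)

/-- Two lines, the second one translated, meet iff their parametrizations take a common value. -/
theorem Eln_inter_translate_nonempty_iff (x y x' y' t : V3) :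
    (Eln x y ∩ ((· + t) '' Eln x' y')).Nonempty ↔
      ∃ α β : ℝ, ∀ i, x i + α * (y i - x i) = x' i + β * (y' i - x' i) + t i := by
  simp only [Eln, Set.Nonempty, Set.mem_inter_iff, Set.mem_image, SetLike.mem_coe,
    mem_affineSpan_pair_iff_exists_lineMap_eq, AffineMap.lineMap_apply_module']
  constructor
  · rintro ⟨_, ⟨α, rfl⟩, _, ⟨β, rfl⟩, h⟩
    refine ⟨α, β, fun i => ?_⟩
    have hi := congrFun h i
    simp only [Pi.add_apply, Pi.smul_apply, Pi.sub_apply, smul_eq_mul] at hi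
    linarith
  · rintro ⟨α, β, h⟩
    refine ⟨_, ⟨α, rfl⟩, _, ⟨β, rfl⟩, funext fun i => ?_⟩
    simp only [Pi.add_apply, Pi.smul_apply, Pi.sub_apply, smul_eq_mul]
    linarith [h i]

/-- the edge-to-edge incidences H_{b+c} and H_{c+a} occur exactly on the
corresponding boundary planes of parameter space. -/
theorem edge_edge_incidence_iff (u v w : ℝ) :
    ((Eln po pr ∩ ((· + (bv u v w + cv u v w)) '' Eln ps pp)).Nonempty ↔
      u/2 + 2*v - w = 33/320) ∧
    ((Eln po pp ∩ ((· + (cv u v w + av u v w)) '' Eln ps pq)).Nonempty ↔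
      -u/2 - 2*v - w = 33/320) := by
  simp only [Eln_inter_translate_nonempty_iff, Fin.forall_fin_succ, IsEmpty.forall_iff, and_true,
    po, pp, pq, pr, ps, av, bv, cv, Pi.add_apply, Matrix.cons_val_zero, Matrix.cons_val_succ]
  constructor
  · constructor
    · rintro ⟨α, β, h₀, h₁, h₂⟩
      linarith
    · intro h
      set β : ℝ := 4 - (27/20 + 753/320 - 3*u/2 - 2*v + w) with hβ
      refine ⟨(4 - 4*β - (-3/10 + 129/160 - 2*u + 2*v + 2*w)) / 3, β, ?_, ?_, ?_⟩ <;> linarith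
  · constructor
    · rintro ⟨α, β, h₀, h₁, h₂⟩
      linarith
    · intro h
      set β : ℝ := 4 - (27/10 + 129/160 + 2*v + 2*w) with hβ
      refine ⟨(4 - 4*β - (21/20 - 237/320 + u/2 - 2*v + 3*w)) / 3, β, ?_, ?_, ?_⟩ <;> linarith
end
end

section
/- For every (u,v,w) ∈ ℝ³, writing a = a(u,v,w), b = b(u,v,w), c = c(u,v,w): the vertex q lies in the translated affine plane F[s,p,r]+b−c if and only if −v + w = 3/64, and the vertex r lies in the translated affine plane F[o,q,p]+c−a if and only if v + w = 3/64. -/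
open Matrix MeasureTheory

noncomputable section

/-- The affine span of three points consists of the points `x + α (y - x) + β (z - x)`. -/
theorem mem_Fpl_iff {x y z p : V3} :
    p ∈ Fpl x y z ↔ ∃ α β : ℝ, p = α • (y - x) + β • (z - x) + x := by
  rw [Fpl, SetLike.mem_coe,
    ← AffineSubspace.vsub_right_mem_direction_iff_mem
      (mem_affineSpan ℝ (Set.mem_insert x {y, z})), direction_affineSpan,
    vectorSpan_eq_span_vsub_set_right ℝ (Set.mem_insert x {y, z})]
  simp only [Set.image_insert_eq, Set.image_singleton, vsub_eq_sub, sub_self,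
    Submodule.span_insert_zero, Submodule.mem_span_pair]
  exact exists_congr fun α => exists_congr fun β => by rw [eq_comm, sub_eq_iff_eq_add]

theorem mem_Fpl_ps_pp_pr_iff (x : V3) : x ∈ Fpl ps pp pr ↔ x 0 - 5 * x 1 + x 2 = 6 := by
  rw [mem_Fpl_iff]
  constructor
  · rintro ⟨α, β, rfl⟩
    simp [ps, pp, pr]
    ring
  · intro h
    refine ⟨(4 * (x 0 + 2) - (x 2 + 2)) / 15, (4 * (x 2 + 2) - (x 0 + 2)) / 15, ?_⟩
    ext i
    fin_cases i <;> simp [ps, pp, pr] <;> linarith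

theorem mem_Fpl_po_pq_pp_iff (x : V3) : x ∈ Fpl po pq pp ↔ x 0 + x 1 - x 2 = 2 := by
  rw [mem_Fpl_iff]
  constructor
  · rintro ⟨α, β, rfl⟩
    simp [po, pq, pp]
    ring
  · intro h
    refine ⟨(2 - x 0) / 3, (2 - x 1) / 3, ?_⟩
    ext i
    fin_cases i <;> simp [po, pq, pp] <;> linarith

/-- the vertex-to-face incidences H_{b−c} and H_{c−a} occur exactly on the
corresponding boundary planes of parameter space. -/
theorem vertex_face_incidence_iff (u v w : ℝ) :
    (pq ∈ (· + (bv u v w - cv u v w)) '' Fpl ps pp pr ↔ -v + w = 3/64) ∧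
    (pr ∈ (· + (cv u v w - av u v w)) '' Fpl po pq pp ↔ v + w = 3/64) := by
  constructor
  · rw [Set.image_add_right, Set.mem_preimage, mem_Fpl_ps_pp_pr_iff]
    simp [pq, bv, cv]
    constructor <;> intro h <;> linarith
  · rw [Set.image_add_right, Set.mem_preimage, mem_Fpl_po_pq_pp_iff]
    simp [pr, av, cv]
    constructor <;> intro h <;> linarith
end
end
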